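/- Let Σ be a binding signature and M, M' : NomTrm nameful terms. If their translations into well-scoped locally nameless terms are equal, ⟦M⟧ = ⟦M'⟧, then M and M' are α-equivalent: M ∼ M' (injectivity of the translation modulo α-equivalence). -/

import Mathlib

/- A Plotkin-style binding signature: operators with arities. -/
structure Sig where
  Op : Type
  ar : Op → List ℕ

/- Well-scoped locally nameless terms and argument lists over a signature.
Atoms are natural numbers. -/
mutual
inductive Trm (S : Sig) : ℕ → Type where
  | idx : {n : ℕ} → Fin n → Trm S n
  | atm : {n : ℕ} → ℕ → Trm S n
  | op  : {n : ℕ} → (o : S.Op) → Args S n (S.ar o) → Trm S n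
inductive Args (S : Sig) : ℕ → List ℕ → Type where
  | nil : {n : ℕ} → Args S n []
  | cons : {n m : ℕ} → {ms : List ℕ} → Trm S (m + n) → Args S n ms → Args S n (m :: ms)
end

variable {S : Sig}

/- Scope weakening. -/
mutual
def Trm.weaken : {m n : ℕ} → m ≤ n → Trm S m → Trm S n
  | _, _, h, .idx i => .idx (Fin.castLE h i)
  | _, _, _, .atm x => .atm x
  | _, _, h, .op o as => .op o (Args.weaken h as)
def Args.weaken : {m n : ℕ} → {ms : List ℕ} → m ≤ n → Args S m ms → Args S n ms
  | _, _, _, _, .nil => .nil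
  | _, _, _, h, .cons t ts => .cons (Trm.weaken (Nat.add_le_add_left h _) t) (Args.weaken h ts)
end

/- Support: the finite set of atoms occurring in a term. -/
mutual
def Trm.supp : {n : ℕ} → Trm S n → Finset ℕ
  | _, .idx _ => ∅
  | _, .atm x => {x}
  | _, .op _ as => Args.supp as
def Args.supp : {n : ℕ} → {ms : List ℕ} → Args S n ms → Finset ℕ
  | _, _, .nil => ∅
  | _, _, .cons t ts => Trm.supp t ∪ Args.supp ts
end

/- Action of a substitution σ : 𝔸 → Trm on terms. -/
mutual
def Trm.subst (σ : ℕ → Trm S 0) : {n : ℕ} → Trm S n → Trm S n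
  | _, .idx i => .idx i
  | n, .atm x => Trm.weaken (Nat.zero_le n) (σ x)
  | _, .op o as => .op o (Args.subst σ as)
def Args.subst (σ : ℕ → Trm S 0) : {n : ℕ} → {ms : List ℕ} → Args S n ms → Args S n ms
  | _, _, .nil => .nil
  | _, _, .cons t ts => .cons (Trm.subst σ t) (Args.subst σ ts)
end

/- The single substitution (x := u). -/
def single (x : ℕ) (u : Trm S 0) : ℕ → Trm S 0 := fun y => if x = y then u else .atm y

/- Renaming a term along ρ : 𝔸 → 𝔸, i.e. substitution along 𝐚 ∘ ρ. -/
def Trm.rename (ρ : ℕ → ℕ) {n : ℕ} (t : Trm S n) : Trm S n :=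
  Trm.subst (fun z => .atm (ρ z)) t

/- Opening (i ↝ u)t : replace index i by the 0-term u. -/
mutual
def Trm.opn : {n : ℕ} → Fin (n+1) → Trm S 0 → Trm S (n+1) → Trm S n
  | n, i, u, .idx j =>
      match finSuccEquiv' i j with
      | none => Trm.weaken (Nat.zero_le n) u
      | some k => .idx k
  | _, _, _, .atm x => .atm x
  | _, i, u, .op o as => .op o (Args.opn i u as)
def Args.opn : {n : ℕ} → {ms : List ℕ} → Fin (n+1) → Trm S 0 → Args S (n+1) ms → Args S n ms
  | _, _, _, _, .nil => .nil
  | _, _, i, u, .cons (m := k) t ts => .cons (Trm.opn (Fin.natAdd k i) u t) (Args.opn i u ts)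
end

/- Concretion t[u] of a (1+n)-term at a 0-term. -/
def Trm.conc {n : ℕ} (t : Trm S (n+1)) (u : Trm S 0) : Trm S n := Trm.opn 0 u t

/- Closing (i ↜ x)t : replace the atom x by the index i. -/
mutual
def Trm.cls : {n : ℕ} → Fin (n+1) → ℕ → Trm S n → Trm S (n+1)
  | _, i, _, .idx j => .idx (i.succAbove j)
  | _, i, x, .atm y => if x = y then .idx i else .atm y
  | _, i, x, .op o as => .op o (Args.cls i x as)
def Args.cls : {n : ℕ} → {ms : List ℕ} → Fin (n+1) → ℕ → Args S n ms → Args S (n+1) ms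
  | _, _, _, _, .nil => .nil
  | _, _, i, x, .cons (m := k) t ts => .cons (Trm.cls (Fin.natAdd k i) x t) (Args.cls i x ts)
end

/- Abstraction ⟨x⟩t. -/
def Trm.abs (x : ℕ) {n : ℕ} (t : Trm S n) : Trm S (n+1) := Trm.cls 0 x t

/- Size of a term. -/
mutual
def Trm.size : {n : ℕ} → Trm S n → ℕ
  | _, .idx _ => 0
  | _, .atm _ => 0
  | _, .op _ as => 1 + Args.size as
def Args.size : {n : ℕ} → {ms : List ℕ} → Args S n ms → ℕ
  | _, _, .nil => 0
  | _, _, .cons t ts => max (Trm.size t) (Args.size ts)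
end

/- Nameful terms, argument lists and n-ary bindings over a signature. -/
mutual
inductive NomTrm (S : Sig) : Type where
  | atm : ℕ → NomTrm S
  | op : (o : S.Op) → NomArg S (S.ar o) → NomTrm S
inductive NomArg (S : Sig) : List ℕ → Type where
  | nil : NomArg S []
  | cons : {m : ℕ} → {ms : List ℕ} → NomBind S m → NomArg S ms → NomArg S (m :: ms)
inductive NomBind (S : Sig) : ℕ → Type where
  | body : NomTrm S → NomBind S 0
  | bind : {m : ℕ} → ℕ → NomBind S m → NomBind S (m+1)
end

/- Support of a nameful term: all atoms occurring, in atom or binding position. -/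
mutual
def NomTrm.nsupp : NomTrm S → Finset ℕ
  | .atm x => {x}
  | .op _ bs => NomArg.nsupp bs
def NomArg.nsupp : {ms : List ℕ} → NomArg S ms → Finset ℕ
  | _, .nil => ∅
  | _, .cons b bs => NomBind.nsupp b ∪ NomArg.nsupp bs
def NomBind.nsupp : {m : ℕ} → NomBind S m → Finset ℕ
  | _, .body M => NomTrm.nsupp M
  | _, .bind x b => insert x (NomBind.nsupp b)
end

/- Renaming of nameful terms: apply ρ to every atom occurrence, including
binding positions. -/
mutual
def NomTrm.rename (ρ : ℕ → ℕ) : NomTrm S → NomTrm S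
  | .atm x => .atm (ρ x)
  | .op o bs => .op o (NomArg.rename ρ bs)
def NomArg.rename (ρ : ℕ → ℕ) : {ms : List ℕ} → NomArg S ms → NomArg S ms
  | _, .nil => .nil
  | _, .cons b bs => .cons (NomBind.rename ρ b) (NomArg.rename ρ bs)
def NomBind.rename (ρ : ℕ → ℕ) : {m : ℕ} → NomBind S m → NomBind S m
  | _, .body M => .body (NomTrm.rename ρ M)
  | _, .bind x b => .bind (ρ x) (NomBind.rename ρ b)
end

/- The single renaming function sending x to y and fixing all other atoms. -/
def rn1 (x y : ℕ) : ℕ → ℕ := fun z => if x = z then y else z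

/- α-equivalence of nameful terms. -/
mutual
inductive AEq {S : Sig} : NomTrm S → NomTrm S → Prop where
  | atm (x : ℕ) : AEq (.atm x) (.atm x)
  | op {o : S.Op} {bs bs' : NomArg S (S.ar o)} :
      AEqArg bs bs' → AEq (.op o bs) (.op o bs')
inductive AEqArg {S : Sig} : {ms : List ℕ} → NomArg S ms → NomArg S ms → Prop where
  | nil : AEqArg .nil .nil
  | cons {m : ℕ} {ms : List ℕ} {b b' : NomBind S m} {bs bs' : NomArg S ms} :
      AEqBind b b' → AEqArg bs bs' → AEqArg (.cons b bs) (.cons b' bs')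
inductive AEqBind {S : Sig} : {m : ℕ} → NomBind S m → NomBind S m → Prop where
  | body {M M' : NomTrm S} : AEq M M' → AEqBind (.body M) (.body M')
  | bind {m : ℕ} {x x' y : ℕ} {b b' : NomBind S m} :
      y ∉ NomBind.nsupp b → y ∉ NomBind.nsupp b' →
      AEqBind (NomBind.rename (rn1 x y) b) (NomBind.rename (rn1 x' y) b') →
      AEqBind (.bind x b) (.bind x' b')
end

/- Translation of nameful terms into well-scoped locally nameless terms;
bindings translate to iterated abstractions. -/
mutual
def NomTrm.transl : NomTrm S → Trm S 0
  | .atm x => .atm x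
  | .op o bs => .op o (NomArg.transl bs)
def NomArg.transl : {ms : List ℕ} → NomArg S ms → Args S 0 ms
  | _, .nil => .nil
  | _, .cons b bs => .cons (NomBind.transl b) (NomArg.transl bs)
def NomBind.transl : {m : ℕ} → NomBind S m → Trm S m
  | _, .body M => NomTrm.transl M
  | _, .bind x b => Trm.cls 0 x (NomBind.transl b)
end

/- A chosen atom not in a given finite set (one more than its maximum). -/
def newAtom (s : Finset ℕ) : ℕ := s.sup id + 1

/- Capture-avoiding substitution of nameful terms for atoms. -/
mutual
def NomTrm.nsubst (σ : ℕ → NomTrm S) : NomTrm S → NomTrm S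
  | .atm x => σ x
  | .op o bs => .op o (NomArg.nsubst σ bs)
def NomArg.nsubst (σ : ℕ → NomTrm S) : {ms : List ℕ} → NomArg S ms → NomArg S ms
  | _, .nil => .nil
  | _, .cons b bs => .cons (NomBind.nsubst σ b) (NomArg.nsubst σ bs)
def NomBind.nsubst (σ : ℕ → NomTrm S) : {m : ℕ} → NomBind S m → NomBind S m
  | _, .body M => .body (NomTrm.nsubst σ M)
  | _, .bind x b =>
      let y := newAtom ((NomBind.nsupp b).biUnion (fun z => NomTrm.nsupp (σ z)))
      .bind y (NomBind.nsubst (fun z => if x = z then .atm y else σ z) b)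
end

/- Renaming nameful terms along the identity. -/
mutual
theorem NomTrm.rename_id : (M : NomTrm S) → M.rename id = M
  | .atm x => by simp [NomTrm.rename]
  | .op o bs => by rw [NomTrm.rename, NomArg.rename_id bs]
theorem NomArg.rename_id : {ms : List ℕ} → (bs : NomArg S ms) → bs.rename id = bs
  | _, .nil => by rw [NomArg.rename]
  | _, .cons b bs => by rw [NomArg.rename, NomBind.rename_id b, NomArg.rename_id bs]
theorem NomBind.rename_id : {m : ℕ} → (b : NomBind S m) → b.rename id = b
  | _, .body M => by rw [NomBind.rename, NomTrm.rename_id M]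
  | _, .bind x b => by rw [NomBind.rename, NomBind.rename_id b, id]
end

/- Renaming nameful terms along a composite. -/
mutual
theorem NomTrm.rename_rename (ρ ρ' : ℕ → ℕ) :
    (M : NomTrm S) → (M.rename ρ).rename ρ' = M.rename (ρ' ∘ ρ)
  | .atm x => by simp [NomTrm.rename]
  | .op o bs => by simp only [NomTrm.rename, NomArg.rename_rename ρ ρ' bs]
theorem NomArg.rename_rename (ρ ρ' : ℕ → ℕ) :
    {ms : List ℕ} → (bs : NomArg S ms) → (bs.rename ρ).rename ρ' = bs.rename (ρ' ∘ ρ)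
  | _, .nil => by simp only [NomArg.rename]
  | _, .cons b bs => by
      simp only [NomArg.rename, NomBind.rename_rename ρ ρ' b, NomArg.rename_rename ρ ρ' bs]
theorem NomBind.rename_rename (ρ ρ' : ℕ → ℕ) :
    {m : ℕ} → (b : NomBind S m) → (b.rename ρ).rename ρ' = b.rename (ρ' ∘ ρ)
  | _, .body M => by simp only [NomBind.rename, NomTrm.rename_rename ρ ρ' M]
  | _, .bind x b => by
      simp only [NomBind.rename, NomBind.rename_rename ρ ρ' b, Function.comp_apply]
end

/- Closing does not introduce atoms. -/
mutual
theorem Trm.supp_cls_subset :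
    {n : ℕ} → (i : Fin (n + 1)) → (x : ℕ) → (t : Trm S n) → (t.cls i x).supp ⊆ t.supp
  | _, i, x, .idx j => by simp [Trm.cls, Trm.supp]
  | _, i, x, .atm y => by
      by_cases h : x = y <;> simp [Trm.cls, Trm.supp, h]
  | _, i, x, .op o as => by
      simpa only [Trm.cls, Trm.supp] using Args.supp_cls_subset i x as
theorem Args.supp_cls_subset :
    {n : ℕ} → {ms : List ℕ} → (i : Fin (n + 1)) → (x : ℕ) → (as : Args S n ms) →
      (as.cls i x).supp ⊆ as.supp
  | _, _, _, _, .nil => by simp [Args.cls, Args.supp]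
  | _, _, i, x, .cons t ts => by
      simp only [Args.cls, Args.supp]
      exact Finset.union_subset_union (Trm.supp_cls_subset _ x t) (Args.supp_cls_subset i x ts)
end

/- The translation does not introduce atoms. -/
mutual
theorem NomTrm.supp_transl_subset : (M : NomTrm S) → M.transl.supp ⊆ M.nsupp
  | .atm x => by simp [NomTrm.transl, Trm.supp, NomTrm.nsupp]
  | .op o bs => by
      simpa only [NomTrm.transl, Trm.supp, NomTrm.nsupp] using NomArg.supp_transl_subset bs
theorem NomArg.supp_transl_subset :
    {ms : List ℕ} → (bs : NomArg S ms) → bs.transl.supp ⊆ bs.nsupp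
  | _, .nil => by simp [NomArg.transl, Args.supp]
  | _, .cons b bs => by
      simp only [NomArg.transl, Args.supp, NomArg.nsupp]
      exact Finset.union_subset_union (NomBind.supp_transl_subset b)
        (NomArg.supp_transl_subset bs)
theorem NomBind.supp_transl_subset : {m : ℕ} → (b : NomBind S m) → b.transl.supp ⊆ b.nsupp
  | _, .body M => by
      simpa only [NomBind.transl, NomBind.nsupp] using NomTrm.supp_transl_subset M
  | _, .bind x b => by
      simp only [NomBind.transl, NomBind.nsupp]
      exact ((Trm.supp_cls_subset 0 x b.transl).trans (NomBind.supp_transl_subset b)).trans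
        (Finset.subset_insert x _)
end

/- Closing at `x` commutes with a renaming that identifies no atom of the term with `x`. -/
mutual
theorem Trm.subst_cls (ρ : ℕ → ℕ) :
    {n : ℕ} → (i : Fin (n + 1)) → (x : ℕ) → (t : Trm S n) →
      (∀ z ∈ t.supp, ρ x = ρ z → x = z) →
      (t.cls i x).subst (fun z => .atm (ρ z)) = (t.subst fun z => .atm (ρ z)).cls i (ρ x)
  | _, i, x, .idx j, _ => by simp [Trm.cls, Trm.subst]
  | _, i, x, .atm y, hinj => by
      by_cases h : x = y
      · simp [Trm.cls, Trm.subst, Trm.weaken, h]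
      · have hne : ρ x ≠ ρ y := fun e => h (hinj y (by simp [Trm.supp]) e)
        simp [Trm.cls, Trm.subst, Trm.weaken, h, hne]
  | _, i, x, .op o as, hinj => by
      simp only [Trm.cls, Trm.subst, Args.subst_cls ρ i x as (by simpa [Trm.supp] using hinj)]
theorem Args.subst_cls (ρ : ℕ → ℕ) :
    {n : ℕ} → {ms : List ℕ} → (i : Fin (n + 1)) → (x : ℕ) → (as : Args S n ms) →
      (∀ z ∈ as.supp, ρ x = ρ z → x = z) →
      (as.cls i x).subst (fun z => .atm (ρ z)) = (as.subst fun z => .atm (ρ z)).cls i (ρ x)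
  | _, _, _, _, .nil, _ => by simp only [Args.cls, Args.subst]
  | n, _, i, x, .cons (m := k) t ts, hinj => by
      have ht := Trm.subst_cls ρ (n := k + n) (Fin.natAdd k i) x t
        fun z hz => hinj z (by simp [Args.supp, hz])
      have hts := Args.subst_cls ρ i x ts fun z hz => hinj z (by simp [Args.supp, hz])
      simp only [Args.cls, Args.subst, hts]
      exact congrArg (Args.cons · _) ht
end

/- Opening a closed term at an atom renames the closed atom. -/
mutual
theorem Trm.opn_cls (y : ℕ) :
    {n : ℕ} → (i : Fin (n + 1)) → (x : ℕ) → (t : Trm S n) →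
      Trm.opn i (.atm y) (t.cls i x) = t.subst fun z => .atm (rn1 x y z)
  | _, i, x, .idx j => by simp [Trm.cls, Trm.subst, Trm.opn]
  | _, i, x, .atm z => by
      by_cases h : x = z <;> simp [Trm.cls, Trm.subst, Trm.opn, Trm.weaken, rn1, h]
  | _, i, x, .op o as => by
      simp only [Trm.cls, Trm.subst, Trm.opn, Args.opn_cls y i x as]
theorem Args.opn_cls (y : ℕ) :
    {n : ℕ} → {ms : List ℕ} → (i : Fin (n + 1)) → (x : ℕ) → (as : Args S n ms) →
      Args.opn i (.atm y) (as.cls i x) = as.subst fun z => .atm (rn1 x y z)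
  | _, _, _, _, .nil => by simp only [Args.cls, Args.subst, Args.opn]
  | n, _, i, x, .cons (m := k) t ts => by
      have ht := Trm.opn_cls y (n := k + n) (Fin.natAdd k i) x t
      simp only [Args.cls, Args.subst, Args.opn, Args.opn_cls y i x ts]
      exact congrArg (Args.cons · _) ht
end

/- The translation commutes with renamings that are injective on the atoms of the term. -/
mutual
theorem NomTrm.transl_rename (ρ : ℕ → ℕ) :
    (M : NomTrm S) → Set.InjOn ρ M.nsupp →
      (M.rename ρ).transl = M.transl.subst fun z => .atm (ρ z)
  | .atm x, _ => by simp [NomTrm.rename, NomTrm.transl, Trm.subst, Trm.weaken]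
  | .op o bs, hinj => by
      simp only [NomTrm.rename, NomTrm.transl, Trm.subst,
        NomArg.transl_rename ρ bs (by simpa only [NomTrm.nsupp] using hinj)]
theorem NomArg.transl_rename (ρ : ℕ → ℕ) :
    {ms : List ℕ} → (bs : NomArg S ms) → Set.InjOn ρ bs.nsupp →
      (bs.rename ρ).transl = bs.transl.subst fun z => .atm (ρ z)
  | _, .nil, _ => by simp only [NomArg.rename, NomArg.transl, Args.subst]
  | _, .cons b bs, hinj => by
      have hb := NomBind.transl_rename ρ b
        (hinj.mono (by simp [NomArg.nsupp]))
      have hbs := NomArg.transl_rename ρ bs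
        (hinj.mono (by simp [NomArg.nsupp]))
      simp only [NomArg.rename, NomArg.transl, Args.subst, hbs]
      exact congrArg (Args.cons · _) hb
theorem NomBind.transl_rename (ρ : ℕ → ℕ) :
    {m : ℕ} → (b : NomBind S m) → Set.InjOn ρ b.nsupp →
      (b.rename ρ).transl = b.transl.subst fun z => .atm (ρ z)
  | _, .body M, hinj => by
      simp only [NomBind.rename, NomBind.transl,
        NomTrm.transl_rename ρ M (by simpa only [NomBind.nsupp] using hinj)]
  | _, .bind x b, hinj => by
      have hb := NomBind.transl_rename ρ b
        (hinj.mono (by simp [NomBind.nsupp]))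
      simp only [NomBind.rename, NomBind.transl, hb]
      refine (Trm.subst_cls ρ 0 x b.transl fun z hz e => hinj ?_ ?_ e).symm
      · simp [NomBind.nsupp]
      · simp [NomBind.nsupp, NomBind.supp_transl_subset b hz]
end

theorem rn1_injOn {x y : ℕ} {s : Finset ℕ} (hy : y ∉ s) : Set.InjOn (rn1 x y) s := by
  intro a ha c hc e
  have hay : a ≠ y := fun h => hy (h ▸ ha)
  have hcy : c ≠ y := fun h => hy (h ▸ hc)
  unfold rn1 at e
  grind

/- Renaming the binder to a fresh atom amounts to concreting the abstraction there. -/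
theorem NomBind.transl_rename_rn1 {m : ℕ} (x y : ℕ) (b : NomBind S m) (hy : y ∉ b.nsupp) :
    (b.rename (rn1 x y)).transl = Trm.opn 0 (.atm y) (b.transl.cls 0 x) := by
  rw [Trm.opn_cls, NomBind.transl_rename _ b (rn1_injOn hy)]

/- Injectivity of the translation, generalized over a renaming of the left-hand term so that
the induction on that term is structural. -/
mutual
theorem NomTrm.aeq_rename_of_transl_eq (ρ : ℕ → ℕ) :
    (M M' : NomTrm S) → (M.rename ρ).transl = M'.transl → AEq (M.rename ρ) M'
  | .atm x, .atm x', h => by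
      simp only [NomTrm.rename, NomTrm.transl, Trm.atm.injEq] at h ⊢
      exact h ▸ AEq.atm _
  | .atm x, .op o' bs', h => by simp [NomTrm.rename, NomTrm.transl] at h
  | .op o bs, .atm x', h => by simp [NomTrm.rename, NomTrm.transl] at h
  | .op o bs, .op o' bs', h => by
      simp only [NomTrm.rename, NomTrm.transl, Trm.op.injEq] at h ⊢
      obtain ⟨rfl, h⟩ := h
      exact AEq.op (NomArg.aeq_rename_of_transl_eq ρ bs bs' (eq_of_heq h))
theorem NomArg.aeq_rename_of_transl_eq (ρ : ℕ → ℕ) :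
    {ms : List ℕ} → (bs bs' : NomArg S ms) → (bs.rename ρ).transl = bs'.transl →
      AEqArg (bs.rename ρ) bs'
  | _, .nil, .nil, _ => by
      rw [NomArg.rename]
      exact AEqArg.nil
  | _, .cons b bs, .cons b' bs', h => by
      simp only [NomArg.rename, NomArg.transl, Args.cons.injEq] at h ⊢
      exact AEqArg.cons (NomBind.aeq_rename_of_transl_eq ρ b b' h.1)
        (NomArg.aeq_rename_of_transl_eq ρ bs bs' h.2)
theorem NomBind.aeq_rename_of_transl_eq (ρ : ℕ → ℕ) :
    {m : ℕ} → (b b' : NomBind S m) → (b.rename ρ).transl = b'.transl →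
      AEqBind (b.rename ρ) b'
  | _, .body M, .body M', h => by
      simp only [NomBind.rename, NomBind.transl] at h ⊢
      exact AEqBind.body (NomTrm.aeq_rename_of_transl_eq ρ M M' h)
  | _, .bind x b, .bind x' b', h => by
      simp only [NomBind.rename, NomBind.transl] at h ⊢
      obtain ⟨y, hy⟩ := Infinite.exists_notMem_finset ((b.rename ρ).nsupp ∪ b'.nsupp)
      obtain ⟨hb, hb'⟩ := Finset.notMem_union.1 hy
      refine AEqBind.bind hb hb' ?_
      have e : ((b.rename ρ).rename (rn1 (ρ x) y)).transl = (b'.rename (rn1 x' y)).transl := by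
        rw [NomBind.transl_rename_rn1 _ _ _ hb, NomBind.transl_rename_rn1 _ _ _ hb', h]
      rw [NomBind.rename_rename] at e ⊢
      exact NomBind.aeq_rename_of_transl_eq _ b _ e
end

/-- Injectivity of the translation modulo α-equivalence: ⟦M⟧ = ⟦M'⟧ → M ∼ M'. -/
theorem transl_injective (S : Sig) (M M' : NomTrm S) (h : M.transl = M'.transl) :
    AEq M M' := by
  have key := NomTrm.aeq_rename_of_transl_eq id M M'
  rw [NomTrm.rename_id] at key
  exact key h
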